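/- Let p ≥ 3 be a prime, m ≥ 3, and let A : Fin m → ℤ/pℤ be injective with A(i) ≠ 0 for all i. Then the kernel lattice L(A) := {a : Fin m → ℤ | Σ_i a(i) • A(i) = 0 in ℤ/pℤ} is generated, as an additive group, by its nonnegative elements a with 2·deg(a) ≤ p + 3; that is, L(A) is generated in degree ≤ (p+3)/2. (This is the lattice form of Theorem 'Upper bound': for G = ℤ/pℤ and a non-modular representation V containing at least 3 distinct nontrivial characters, β_field(G,V) ≤ (p+3)/2.) -/

import Mathlib

/-- The kernel lattice `L(χ) = {a : Fin m → ℤ | ∑ i, a i • χ i = 0}` of a family of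
elements `χ : Fin m → Γ` of an additive abelian group. -/
def latticeOf {m : ℕ} {Γ : Type*} [AddCommGroup Γ] (χ : Fin m → Γ) :
    AddSubgroup (Fin m → ℤ) where
  carrier := {a | ∑ i, a i • χ i = 0}
  zero_mem' := by simp
  add_mem' := by
    intro a b ha hb
    simp only [Set.mem_setOf_eq] at ha hb ⊢
    simp only [Pi.add_apply, add_smul, Finset.sum_add_distrib, ha, hb, add_zero]
  neg_mem' := by
    intro a ha
    simp only [Set.mem_setOf_eq] at ha ⊢
    simp only [Pi.neg_apply, neg_smul, Finset.sum_neg_distrib, ha, neg_zero]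

open scoped Pointwise

/-- `Reach A k g` says that `g` is a sum of at most `k` members (with repetition) of the
family `A`. -/
def Reach {m : ℕ} {Γ : Type*} [AddCommGroup Γ] (A : Fin m → Γ) (k : ℕ) (g : Γ) : Prop :=
  ∃ w : Fin m → ℤ, (∀ i, 0 ≤ w i) ∧ ∑ i, w i ≤ k ∧ ∑ i, w i • A i = g

namespace Reach

variable {m : ℕ} {Γ : Type*} [AddCommGroup Γ] {A : Fin m → Γ}

theorem zero (k : ℕ) : Reach A k 0 := ⟨0, by simp, by simp, by simp⟩

theorem single (i : Fin m) : Reach A 1 (A i) := by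
  refine ⟨Pi.single i 1, fun j => ?_, by simp, by simp [Pi.single_apply]⟩
  by_cases h : j = i <;> simp [h]

theorem mono {k l : ℕ} {g : Γ} (h : Reach A k g) (hkl : k ≤ l) : Reach A l g := by
  obtain ⟨w, h0, hk, hg⟩ := h
  exact ⟨w, h0, hk.trans (by exact_mod_cast hkl), hg⟩

theorem add {k l : ℕ} {g h : Γ} (hg : Reach A k g) (hh : Reach A l h) :
    Reach A (k + l) (g + h) := by
  obtain ⟨w, h0, hk, rfl⟩ := hg
  obtain ⟨v, h0', hk', rfl⟩ := hh
  refine ⟨w + v, fun i => add_nonneg (h0 i) (h0' i), ?_, ?_⟩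
  · simp only [Pi.add_apply, Finset.sum_add_distrib]
    push_cast
    linarith
  · simp only [Pi.add_apply, add_smul, Finset.sum_add_distrib]

theorem nsmul (n : ℕ) (i : Fin m) : Reach A n (n • A i) := by
  induction n with
  | zero => simpa using zero 0
  | succ n ih => simpa [succ_nsmul] using ih.add (single i)

theorem of_mem_nsmul [DecidableEq Γ] {S : Finset Γ} (hS : ∀ g ∈ S, Reach A 1 g) :
    ∀ (k : ℕ) (g : Γ), g ∈ k • S → Reach A k g := by
  intro k
  induction k with
  | zero =>
    intro g hg
    have : g = 0 := by simpa using hg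
    exact this ▸ zero 0
  | succ k ih =>
    intro g hg
    rw [succ_nsmul] at hg
    obtain ⟨x, hx, y, hy, rfl⟩ := Finset.mem_add.1 hg
    exact (ih x hx).add (hS y hy)

/-- A reachable element has a nonnegative representation of least degree. -/
theorem exists_minimal {k : ℕ} {g : Γ} (h : Reach A k g) :
    ∃ w : Fin m → ℤ, (∀ i, 0 ≤ w i) ∧ ∑ i, w i • A i = g ∧
      ∀ l : ℕ, Reach A l g → ∑ i, w i ≤ l := by
  classical
  have hex : ∃ k, Reach A k g := ⟨k, h⟩
  obtain ⟨w, h0, hk, hg⟩ := Nat.find_spec hex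
  exact ⟨w, h0, hg, fun l hl => hk.trans (by exact_mod_cast Nat.find_min' hex hl)⟩

end Reach

theorem mem_latticeOf {m : ℕ} {Γ : Type*} [AddCommGroup Γ] {χ : Fin m → Γ} {a : Fin m → ℤ} :
    a ∈ latticeOf χ ↔ ∑ i, a i • χ i = 0 := Iff.rfl

/-- If `g` and `-A s - g` together always need at most `(p + 1) / 2` summands, then the kernel
lattice is generated in degree at most `(p + 3) / 2`. -/
theorem closure_eq_latticeOf_of_reach {p m : ℕ} (hp : p.Prime) (A : Fin m → ZMod p) (s : Fin m)
    (hs : A s ≠ 0)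
    (h : ∀ g, ∃ i j, Reach A i g ∧ Reach A j (-A s - g) ∧ 2 * (i + j) ≤ p + 1) :
    AddSubgroup.closure
        {a | a ∈ latticeOf A ∧ (∀ i, 0 ≤ a i) ∧ 2 * ∑ i, a i ≤ (p : ℤ) + 3} =
      latticeOf A := by
  have : Fact p.Prime := ⟨hp⟩
  set M := AddSubgroup.closure
    {a | a ∈ latticeOf A ∧ (∀ i, 0 ≤ a i) ∧ 2 * ∑ i, a i ≤ (p : ℤ) + 3}
  have hML : M ≤ latticeOf A := (AddSubgroup.closure_le _).2 fun a ha => ha.1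
  refine le_antisymm hML ?_
  have hmin : ∀ g, ∃ w : Fin m → ℤ, (∀ i, 0 ≤ w i) ∧ ∑ i, w i • A i = g ∧
      ∀ l : ℕ, Reach A l g → ∑ i, w i ≤ l := fun g => by
    obtain ⟨i, _, hi, _⟩ := h g
    exact hi.exists_minimal
  choose W hW0 hWg hWmin using hmin
  have hdeg : ∀ g, 2 * (∑ i, W g i + ∑ i, W (-A s - g) i) ≤ (p : ℤ) + 1 := fun g => by
    obtain ⟨i, j, hi, hj, hij⟩ := h g
    have h1 := hWmin _ _ hi
    have h2 := hWmin _ _ hj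
    zify at hij
    linarith
  have hWnn : ∀ g, 0 ≤ ∑ i, W g i := fun g => Finset.sum_nonneg fun i _ => hW0 g i
  have hW00 : W 0 = 0 := by
    have h1 := hWmin 0 0 (Reach.zero 0)
    have h2 : ∑ i, W 0 i = 0 := le_antisymm (by simpa using h1) (hWnn 0)
    funext i
    exact (Finset.sum_eq_zero_iff_of_nonneg fun i _ => hW0 0 i).1 h2 i (Finset.mem_univ i)
  let e : Fin m → Fin m → ℤ := fun i => Pi.single i 1
  have he0 : ∀ i j, 0 ≤ e i j := fun i j => by
    by_cases h : j = i <;> simp [e, h]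
  have hedeg : ∀ i, ∑ j, e i j = 1 := fun i => by simp [e]
  have heA : ∀ i, ∑ j, e i j • A j = A i := fun i => by simp [e, Pi.single_apply]
  have hWe : ∀ g i, -A i = g → 2 * ∑ j, W g j ≤ (p : ℤ) + 1 → W g + e i ∈ M := by
    intro g i hg hd
    refine AddSubgroup.subset_closure ⟨?_, fun j => add_nonneg (hW0 g j) (he0 i j), ?_⟩
    · rw [mem_latticeOf]
      simp only [Pi.add_apply, add_smul, Finset.sum_add_distrib, heA, hWg, ← hg]
      simp
    · simp only [Pi.add_apply, Finset.sum_add_distrib, hedeg]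
      linarith
  have hlink : ∀ g, W g + W (-A s - g) + e s ∈ M := by
    intro g
    refine AddSubgroup.subset_closure
      ⟨?_, fun j => add_nonneg (add_nonneg (hW0 _ j) (hW0 _ j)) (he0 s j), ?_⟩
    · rw [mem_latticeOf]
      simp only [Pi.add_apply, add_smul, Finset.sum_add_distrib, heA, hWg]
      abel
    · simp only [Pi.add_apply, Finset.sum_add_distrib, hedeg]
      linarith [hdeg g]
  have hopp : ∀ g, W (g + A s) + W (-A s - g) ∈ M := by
    intro g
    refine AddSubgroup.subset_closure ⟨?_, fun j => add_nonneg (hW0 _ j) (hW0 _ j), ?_⟩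
    · rw [mem_latticeOf]
      simp only [Pi.add_apply, add_smul, Finset.sum_add_distrib, hWg]
      abel
    · have h1 : Reach A (∑ i, W g i).toNat g :=
        ⟨W g, hW0 g, by simp, hWg g⟩
      have h2 := hWmin _ _ (h1.add (Reach.single s))
      rw [Nat.cast_add, Int.toNat_of_nonneg (hWnn g), Nat.cast_one] at h2
      simp only [Pi.add_apply, Finset.sum_add_distrib]
      linarith [hdeg g]
  have hstep : ∀ g, W (g + A s) - W g - e s ∈ M := fun g => by
    have := M.sub_mem (hopp g) (hlink g)
    convert this using 1
    abel
  have hmul : ∀ n : ℕ, W (n • A s) - n • e s ∈ M := by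
    intro n
    induction n with
    | zero => simp [hW00]
    | succ n ih =>
      have := M.add_mem ih (hstep (n • A s))
      rw [succ_nsmul, succ_nsmul]
      convert this using 1
      abel
  have hps : p • e s ∈ M := by
    have := hmul p
    rw [nsmul_eq_mul, CharP.cast_eq_zero, zero_mul, hW00, zero_sub] at this
    exact (neg_mem_iff).1 this
  have hgen : ∀ i, ∃ N : ℤ, e i - N • e s ∈ M := by
    intro i
    have hval : (-A i / A s).val • A s = -A i := by
      rw [nsmul_eq_mul, ZMod.natCast_zmod_val, div_mul_cancel₀ _ hs]
    have h1 := hmul (-A i / A s).val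
    rw [hval] at h1
    have h2 := hWe (-A i) i rfl (by linarith [hdeg (-A i), hWnn (-A s - -A i)])
    refine ⟨-((-A i / A s).val : ℤ), ?_⟩
    have := M.sub_mem h2 h1
    rw [neg_smul, natCast_zsmul]
    convert this using 1
    abel
  choose N hN using hgen
  intro a ha
  have hsum : a - (∑ i, a i * N i) • e s ∈ M := by
    have h1 : ∑ i, a i • (e i - N i • e s) ∈ M :=
      M.sum_mem fun i _ => M.zsmul_mem (hN i) _
    have h2 : ∑ i, a i • e i = a := by
      funext j
      simp [e, Finset.sum_apply, Pi.single_apply]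
    simpa only [smul_sub, Finset.sum_sub_distrib, h2, smul_smul, ← Finset.sum_smul] using h1
  have hzero : ((∑ i, a i * N i : ℤ) : ZMod p) = 0 := by
    have h1 := (latticeOf A).sub_mem ha (hML hsum)
    rw [sub_sub_cancel, mem_latticeOf] at h1
    simp only [Pi.smul_apply, smul_assoc, ← Finset.smul_sum, heA] at h1
    rw [zsmul_eq_mul] at h1
    exact (mul_eq_zero.1 h1).resolve_right hs
  obtain ⟨q, hq⟩ := (ZMod.intCast_zmod_eq_zero_iff_dvd _ p).1 hzero
  rw [hq, mul_comm, mul_smul, natCast_zsmul] at hsum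
  simpa using M.add_mem hsum (M.zsmul_mem hps q)

/-- The hypothesis of `closure_eq_latticeOf_of_reach` holds when `A t = β • A s`, provided that
`β` is small compared to `p`. -/
theorem reach_of_ratio {p m : ℕ} (hp : p.Prime) {A : Fin m → ZMod p} {s t : Fin m}
    (hs : A s ≠ 0) {β : ℕ} (hβ : 0 < β) (hst : A t = β • A s)
    (hQ : ∀ Q, p + 1 ≤ Q * β + 2 * β → p ≤ 2 * (Q * β) - 2 * Q + 3) (g : ZMod p) :
    ∃ i j, Reach A i g ∧ Reach A j (-A s - g) ∧ 2 * (i + j) ≤ p + 1 := by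
  have : Fact p.Prime := ⟨hp⟩
  have key : ∀ n : ℕ, Reach A (n / β + n % β) (n • A s) := fun n => by
    have := (Reach.nsmul (A := A) (n / β) t).add (Reach.nsmul (n % β) s)
    rwa [hst, smul_smul, ← add_smul, mul_comm, Nat.div_add_mod] at this
  have hlt := ZMod.val_lt (g / A s)
  set n := (g / A s).val with hn
  have hg : n • A s = g := by
    rw [hn, nsmul_eq_mul, ZMod.natCast_zmod_val, div_mul_cancel₀ _ hs]
  have hg' : (p - 1 - n) • A s = -A s - g := by
    have : (p - 1 - n) • A s + A s + n • A s = 0 := by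
      rw [← succ_nsmul, ← add_smul, show p - 1 - n + 1 + n = p by omega, nsmul_eq_mul,
        CharP.cast_eq_zero, zero_mul]
    rw [hg] at this
    linear_combination this
  refine ⟨_, _, hg ▸ key n, hg' ▸ key (p - 1 - n), ?_⟩
  have h1 := Nat.div_add_mod' n β
  have h2 := Nat.div_add_mod' (p - 1 - n) β
  have h3 := Nat.mod_lt n hβ
  have h4 := Nat.mod_lt (p - 1 - n) hβ
  have h5 := hQ (n / β + (p - 1 - n) / β)
  have h6 : n / β ≤ n / β * β := Nat.le_mul_of_pos_right _ hβ
  have h7 : (p - 1 - n) / β ≤ (p - 1 - n) / β * β := Nat.le_mul_of_pos_right _ hβ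
  rw [add_mul] at h5
  generalize n / β * β = x at *
  generalize (p - 1 - n) / β * β = y at *
  omega

/-- If `S` has at least four elements and `S + S` at least nine, then every `k • S` has at
least `min p (4 * k)` elements. -/
theorem min_le_card_nsmul {p : ℕ} (hp : p.Prime) {S : Finset (ZMod p)} (h4 : 4 ≤ S.card)
    (h9 : 9 ≤ (S + S).card) (k : ℕ) : min p (4 * k) ≤ (k • S).card := by
  have hne : S.Nonempty := Finset.card_pos.1 (by omega)
  have hne2 : (S + S).Nonempty := hne.add hne
  have heven : ∀ j : ℕ, min p (8 * j + 1) ≤ ((2 * j) • S).card := by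
    intro j
    induction j with
    | zero => simp
    | succ j ih =>
      have hj : ((2 * j) • S).Nonempty := hne.nsmul
      have := ZMod.cauchy_davenport hp hj hne2
      rw [show 2 * (j + 1) = 2 * j + 2 by ring, add_nsmul, two_nsmul]
      omega
  obtain ⟨j, rfl | rfl⟩ := Nat.even_or_odd' k
  · have := heven j
    omega
  · have hj : ((2 * j) • S).Nonempty := hne.nsmul
    have := ZMod.cauchy_davenport hp hj hne
    have := heven j
    rw [succ_nsmul]
    omega

/-- If `S` consists of zero and members of `A`, `#S ≥ 4` and `#(S + S) ≥ 9`, then the hypothesis of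
`closure_eq_latticeOf_of_reach` holds at `s` or at `t`. -/
theorem reach_of_card {p m : ℕ} (hp : p.Prime) (hp3 : 3 ≤ p) {A : Fin m → ZMod p} {s t : Fin m}
    (hst : A s ≠ A t) {S : Finset (ZMod p)} (hS : ∀ g ∈ S, Reach A 1 g) (h4 : 4 ≤ S.card)
    (h9 : 9 ≤ (S + S).card) :
    (∀ g, ∃ i j, Reach A i g ∧ Reach A j (-A s - g) ∧ 2 * (i + j) ≤ p + 1) ∨
      (∀ g, ∃ i j, Reach A i g ∧ Reach A j (-A t - g) ∧ 2 * (i + j) ≤ p + 1) := by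
  have : Fact p.Prime := ⟨hp⟩
  have hcard := min_le_card_nsmul hp h4 h9
  have hR := Reach.of_mem_nsmul hS
  have hfull : ∀ k, p ≤ 4 * k → ∀ g, Reach A k g := by
    intro k hk g
    refine hR k g ?_
    have : k • S = Finset.univ := by
      rw [← Finset.card_eq_iff_eq_univ, ZMod.card]
      have h1 := hcard k
      have h2 := Finset.card_le_univ (k • S)
      rw [ZMod.card] at h2
      omega
    simp [this]
  have hodd := hp.eq_two_or_odd
  obtain ⟨k, hk | hk⟩ : ∃ k, p = 4 * k + 1 ∨ p = 4 * k + 3 := ⟨p / 4, by omega⟩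
  · have hmiss : ∀ x y, ¬ Reach A k x → ¬ Reach A k y → x = y := by
      intro x y hx hy
      by_contra hxy
      have h1 : k • S ⊆ Finset.univ \ {x, y} := by
        intro z hz
        have hz' := hR k z hz
        simp only [Finset.mem_sdiff, Finset.mem_univ, true_and, Finset.mem_insert,
          Finset.mem_singleton, not_or]
        exact ⟨fun h => hx (h ▸ hz'), fun h => hy (h ▸ hz')⟩
      have h2 := Finset.card_le_card h1
      rw [Finset.card_sdiff_of_subset (Finset.subset_univ _), Finset.card_univ, ZMod.card,
        Finset.card_pair hxy] at h2
      have h3 := hcard k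
      omega
    have hbad : ∀ i, (¬ ∀ g, ∃ l j, Reach A l g ∧ Reach A j (-A i - g) ∧ 2 * (l + j) ≤ p + 1) →
        ∃ g, ¬ Reach A k g ∧ -A i - g = g := by
      intro i hi
      obtain ⟨g, hg⟩ := not_forall.1 hi
      have h1 : ¬ Reach A k g := fun h =>
        hg ⟨k, k + 1, h, hfull _ (by omega) _, by omega⟩
      have h2 : ¬ Reach A k (-A i - g) := fun h =>
        hg ⟨k + 1, k, hfull _ (by omega) _, h, by omega⟩
      exact ⟨g, h1, hmiss _ _ h2 h1⟩
    by_contra hcon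
    obtain ⟨hcs, hct⟩ := not_or.1 hcon
    obtain ⟨x, hx, hxs⟩ := hbad s hcs
    obtain ⟨y, hy, hyt⟩ := hbad t hct
    have hxy := hmiss x y hx hy
    subst hxy
    exact hst (by linear_combination hyt - hxs)
  · exact Or.inl fun g =>
      ⟨k + 1, k + 1, hfull _ (by omega) _, hfull _ (by omega) _, by omega⟩

/-- In a field in which `2 ≠ 0`, if none of the sums of two elements of `{0, a, b, c}` other
than `a + b` coincide, then there are at least nine such sums. -/
theorem nine_le_card_add_self {F : Type*} [Field F] [DecidableEq F] (h2 : (2 : F) ≠ 0)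
    {a b c : F} (ha : a ≠ 0) (hb : b ≠ 0) (hc : c ≠ 0) (hab : a ≠ b) (hac : a ≠ c) (hbc : b ≠ c)
    (hr : a ≠ 2 * b ∧ b ≠ 2 * a ∧ a ≠ 2 * c ∧ c ≠ 2 * a ∧ b ≠ 2 * c ∧ c ≠ 2 * b)
    (h1 : a + c ≠ 0 ∧ a + c ≠ 2 * b ∧ a + c ≠ b) (h3 : b + c ≠ 0 ∧ b + c ≠ 2 * a ∧ b + c ≠ a) :
    9 ≤ (({0, a, b, c} : Finset F) + {0, a, b, c}).card := by
  obtain ⟨r1, r2, r3, r4, r5, r6⟩ := hr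
  obtain ⟨s1, s2, s3⟩ := h1
  obtain ⟨t1, t2, t3⟩ := h3
  have hsub : ({0, a, b, c, a + a, b + b, c + c, a + c, b + c} : Finset F) ⊆
      ({0, a, b, c} : Finset F) + {0, a, b, c} := by
    intro x hx
    simp only [Finset.mem_insert, Finset.mem_singleton] at hx
    rw [Finset.mem_add]
    rcases hx with rfl | rfl | rfl | rfl | rfl | rfl | rfl | rfl | rfl
    · exact ⟨0, by simp, 0, by simp, by simp⟩
    · exact ⟨0, by simp, x, by simp, by simp⟩
    · exact ⟨0, by simp, x, by simp, by simp⟩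
    · exact ⟨0, by simp, x, by simp, by simp⟩
    · exact ⟨a, by simp, a, by simp, rfl⟩
    · exact ⟨b, by simp, b, by simp, rfl⟩
    · exact ⟨c, by simp, c, by simp, rfl⟩
    · exact ⟨a, by simp, c, by simp, rfl⟩
    · exact ⟨b, by simp, c, by simp, rfl⟩
  refine le_trans (le_of_eq ?_) (Finset.card_le_card hsub)
  have hdbl : ∀ x y : F, x + x = y + y → x = y := fun x y h =>
    mul_left_cancel₀ h2 (by linear_combination h)
  have hd0 : ∀ x : F, x ≠ 0 → x + x ≠ 0 := fun x hx h => hx (hdbl x 0 (by simpa using h))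
  have := hd0 a ha
  have := hd0 b hb
  have := hd0 c hc
  have := mt (hdbl a b) hab
  have := mt (hdbl a c) hac
  have := mt (hdbl b c) hbc
  clear hsub hdbl hd0
  symm
  repeat rw [Finset.card_insert_of_notMem]
  · simp
  all_goals
    simp only [Finset.mem_insert, Finset.mem_singleton, not_or]
    try constructorm* _ ∧ _
    all_goals grind

/-- If two of the sums of pairs of distinct elements of `{x, y, z}` coincide with other sums of
two elements of `{0, x, y, z}`, then some quotient of two of `x, y, z` equals `2` or `3`. -/
theorem exists_ratio_of_coincidences {F : Type*} [Field F] (h2 : (2 : F) ≠ 0)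
    (h3 : (3 : F) ≠ 0) {x y z : F} (hx : x ≠ 0) (hyz : y ≠ z)
    (hy' : x + y = 0 ∨ x + y = 2 * z ∨ x + y = z) (hz' : x + z = 0 ∨ x + z = 2 * y ∨ x + z = y) :
    y = 2 * x ∨ z = 2 * x ∨ z = 2 * y ∨ y = 2 * z ∨ z = 3 * y ∨ y = 3 * z := by
  rcases hy' with e | e | e <;> rcases hz' with f | f | f
  · exact absurd (by linear_combination e - f) hyz
  · exact Or.inr (Or.inr (Or.inr (Or.inr (Or.inl (by linear_combination f - e)))))
  · exact Or.inr (Or.inr (Or.inl (by linear_combination f - e)))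
  · exact Or.inr (Or.inr (Or.inr (Or.inr (Or.inr (by linear_combination e - f)))))
  · exact absurd (mul_left_cancel₀ h3 (by linear_combination e - f)) hyz
  · exact Or.inr (Or.inl (by linear_combination -e - f))
  · exact Or.inr (Or.inr (Or.inr (Or.inl (by linear_combination e - f))))
  · exact Or.inl (by linear_combination -e - f)
  · exact absurd (by linear_combination e + f) (mul_ne_zero h2 hx)

/-- Three distinct nonzero elements of a field in which `2` and `3` are nonzero, no two
of which have quotient `2` or `3`, form with `0` a set having at least nine sums of pairs. -/
theorem nine_le_card_add_self_of_ratio_ne {F : Type*} [Field F] [DecidableEq F]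
    (h2 : (2 : F) ≠ 0) (h3 : (3 : F) ≠ 0) {f : Fin 3 → F} (hf : Function.Injective f)
    (h0 : ∀ i, f i ≠ 0) (hr2 : ∀ i j, f j ≠ 2 * f i) (hr3 : ∀ i j, f j ≠ 3 * f i) :
    9 ≤ (insert 0 (Finset.univ.image f) + insert 0 (Finset.univ.image f)).card := by
  have main : ∀ i j k : Fin 3, i ≠ j → i ≠ k → j ≠ k →
      (f i + f k ≠ 0 ∧ f i + f k ≠ 2 * f j ∧ f i + f k ≠ f j) →
      (f j + f k ≠ 0 ∧ f j + f k ≠ 2 * f i ∧ f j + f k ≠ f i) →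
      9 ≤ (insert 0 (Finset.univ.image f) + insert 0 (Finset.univ.image f)).card := by
    intro i j k hij hik hjk hc hc'
    have hset : insert 0 (Finset.univ.image f) = ({0, f i, f j, f k} : Finset F) := by
      have : (Finset.univ : Finset (Fin 3)) = {i, j, k} := by
        clear hc hc'
        revert i j k
        decide
      rw [this, Finset.image_insert, Finset.image_insert, Finset.image_singleton]
    rw [hset]
    exact nine_le_card_add_self h2 (h0 i) (h0 j) (h0 k) (hf.ne hij) (hf.ne hik) (hf.ne hjk)
      ⟨hr2 _ _, hr2 _ _, hr2 _ _, hr2 _ _, hr2 _ _, hr2 _ _⟩ hc hc'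
  have two : ∀ i j k : Fin 3, j ≠ k → ¬ (f i + f j ≠ 0 ∧ f i + f j ≠ 2 * f k ∧ f i + f j ≠ f k) →
      (f i + f k ≠ 0 ∧ f i + f k ≠ 2 * f j ∧ f i + f k ≠ f j) := by
    intro i j k hjk hj
    by_contra hk
    have hj' : f i + f j = 0 ∨ f i + f j = 2 * f k ∨ f i + f j = f k := by tauto
    have hk' : f i + f k = 0 ∨ f i + f k = 2 * f j ∨ f i + f k = f j := by tauto
    rcases exists_ratio_of_coincidences h2 h3 (h0 i) (hf.ne hjk) hj' hk' with h | h | h | h | h | h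
    · exact hr2 _ _ h
    · exact hr2 _ _ h
    · exact hr2 _ _ h
    · exact hr2 _ _ h
    · exact hr3 _ _ h
    · exact hr3 _ _ h
  by_cases h01 : f 0 + f 1 ≠ 0 ∧ f 0 + f 1 ≠ 2 * f 2 ∧ f 0 + f 1 ≠ f 2
  · by_cases h02 : f 0 + f 2 ≠ 0 ∧ f 0 + f 2 ≠ 2 * f 1 ∧ f 0 + f 2 ≠ f 1
    · refine main 1 2 0 (by decide) (by decide) (by decide) ?_ ?_
      · rwa [add_comm (f 1)]
      · rwa [add_comm (f 2)]
    · have h12 := two 2 0 1 (by decide) (by rwa [add_comm (f 2)])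
      refine main 0 2 1 (by decide) (by decide) (by decide) h01 h12
  · have h02 := two 0 1 2 (by decide) h01
    have h12 := two 1 0 2 (by decide) (by rwa [add_comm (f 1)])
    exact main 0 1 2 (by decide) (by decide) (by decide) h02 h12

/-- For `p ≥ 3` prime, `m ≥ 3`, and `A : Fin m → ℤ/pℤ` injective with all values
nonzero, the kernel lattice `L(A)` is generated, as an additive group, by its nonnegative
elements `a` with `2 · deg a ≤ p + 3`, i.e. generated in degree `≤ (p+3)/2`. -/
theorem stmt_2 (p m : ℕ) (hp : p.Prime) (hp3 : 3 ≤ p) (hm : 3 ≤ m)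
    (A : Fin m → ZMod p) (hinj : Function.Injective A) (hA : ∀ i, A i ≠ 0) :
    AddSubgroup.closure
        {a | a ∈ latticeOf A ∧ (∀ i, 0 ≤ a i) ∧ 2 * ∑ i, a i ≤ (p : ℤ) + 3} =
      latticeOf A := by
  have : Fact p.Prime := ⟨hp⟩
  have hp5 : 5 ≤ p := by
    have h1 : (insert 0 (Finset.univ.image A)).card ≤ p := by
      simpa [ZMod.card] using Finset.card_le_univ (insert 0 (Finset.univ.image A))
    rw [Finset.card_insert_of_notMem (by simp [hA]), Finset.card_image_of_injective _ hinj,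
      Finset.card_univ, Fintype.card_fin] at h1
    have h4 : p ≠ 4 := by
      rintro rfl
      exact absurd hp (by norm_num)
    omega
  have hcast : ∀ n : ℕ, 0 < n → n < p → (n : ZMod p) ≠ 0 := fun n hn hnp h =>
    absurd (Nat.le_of_dvd hn ((ZMod.natCast_eq_zero_iff n p).1 h)) (by omega)
  have h2 : (2 : ZMod p) ≠ 0 := by exact_mod_cast hcast 2 (by omega) (by omega)
  have h3 : (3 : ZMod p) ≠ 0 := by exact_mod_cast hcast 3 (by omega) (by omega)
  by_cases hr2 : ∃ i j, A j = 2 * A i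
  · obtain ⟨i, j, h⟩ := hr2
    refine closure_eq_latticeOf_of_reach hp A i (hA i)
      (reach_of_ratio hp (hA i) (t := j) two_pos (by rw [h, nsmul_eq_mul, Nat.cast_ofNat]) ?_)
    intro Q hQ
    omega
  by_cases hr3 : ∃ i j, A j = 3 * A i
  · obtain ⟨i, j, h⟩ := hr3
    have hp5' : p ≠ 5 := by
      rintro rfl
      have h5 : (5 : ZMod 5) = 0 := by exact_mod_cast CharP.cast_eq_zero (ZMod 5) 5
      exact hr2 ⟨j, i, by linear_combination (-2) * h - A i * h5⟩
    have hp6 : p ≠ 6 := by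
      rintro rfl
      exact absurd hp (by norm_num)
    have hp8 : p ≠ 8 := by
      rintro rfl
      exact absurd hp (by norm_num)
    have hp9 : p ≠ 9 := by
      rintro rfl
      exact absurd hp (by norm_num)
    have hp10 : p ≠ 10 := by
      rintro rfl
      exact absurd hp (by norm_num)
    refine closure_eq_latticeOf_of_reach hp A i (hA i)
      (reach_of_ratio hp (hA i) (t := j) three_pos (by rw [h, nsmul_eq_mul, Nat.cast_ofNat]) ?_)
    intro Q hQ
    omega
  push Not at hr2 hr3
  let ι : Fin 3 → Fin m := Fin.castLE hm
  have hι : Function.Injective (A ∘ ι) := hinj.comp (Fin.castLE_injective hm)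
  have h9 := nine_le_card_add_self_of_ratio_ne h2 h3 hι (fun i => hA (ι i))
    (fun i j => hr2 (ι i) (ι j)) (fun i j => hr3 (ι i) (ι j))
  have h4 : 4 ≤ (insert 0 (Finset.univ.image (A ∘ ι))).card := by
    rw [Finset.card_insert_of_notMem (by simp [hA]), Finset.card_image_of_injective _ hι,
      Finset.card_univ, Fintype.card_fin]
  have hS : ∀ g ∈ insert 0 (Finset.univ.image (A ∘ ι)), Reach A 1 g := by
    intro g hg
    rcases Finset.mem_insert.1 hg with rfl | hg
    · exact Reach.zero 1
    · obtain ⟨i, -, rfl⟩ := Finset.mem_image.1 hg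
      exact Reach.single (ι i)
  rcases reach_of_card hp hp3 (A := A) (s := ι 0) (t := ι 1)
    (hι.ne (show (0 : Fin 3) ≠ 1 by decide)) hS h4 h9 with h | h
  · exact closure_eq_latticeOf_of_reach hp A (ι 0) (hA _) h
  · exact closure_eq_latticeOf_of_reach hp A (ι 1) (hA _) h
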